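/- arXiv:1003.1423 — 2 statements merged into one kernel-verified Lean document; each statement's English description precedes it below -/
import Mathlib

section
/- Suppose p : [0,∞) → ℝ × ℝ is differentiable, the second coordinate of p(t) is strictly positive for every t ≥ 0, and p satisfies the gradient-descent equation p′(t) = −∇C_exp(p(t)) for all t ≥ 0 (where ∇C_exp is the Euclidean gradient of C_exp, which exists at points with positive second coordinate). Then p(t) converges as t → ∞ to the unique global minimizer of C_exp over ℝ × [0,∞). -/
open Real MeasureTheory Filter

theorem ConvexOn.sub_le_inner_gradient {E : Type*} [NormedAddCommGroup E] [InnerProductSpace ℝ E]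
    [CompleteSpace E] {F : E → ℝ} (hF : ConvexOn ℝ Set.univ F) {x : E}
    (hx : DifferentiableAt ℝ F x) (y : E) :
    F x - F y ≤ inner ℝ (x - y) (gradient F x) := by
  have hline : HasDerivAt (fun s : ℝ => AffineMap.lineMap (k := ℝ) x y s) (y - x) 0 :=
    AffineMap.hasDerivAt_lineMap
  have hgrad : HasFDerivAt F (fderiv ℝ F x) (AffineMap.lineMap (k := ℝ) x y (0 : ℝ)) := by
    simpa using hx.hasFDerivAt
  have hconv : ConvexOn ℝ Set.univ (F ∘ AffineMap.lineMap (k := ℝ) x y) := by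
    simpa using hF.comp_affineMap (AffineMap.lineMap (k := ℝ) x y)
  have hslope := hconv.le_slope_of_hasDerivAt (Set.mem_univ 0) (Set.mem_univ 1) one_pos
    (hgrad.comp_hasDerivAt 0 hline)
  have hinner : inner ℝ (y - x) (gradient F x) = fderiv ℝ F x (y - x) := by
    rw [real_inner_comm]
    exact InnerProductSpace.toDual_symm_apply
  have hneg : inner ℝ (x - y) (gradient F x) = -inner ℝ (y - x) (gradient F x) := by
    rw [← inner_neg_left, neg_sub]
  simp only [slope_def_field, Function.comp_apply, AffineMap.lineMap_apply_one,
    AffineMap.lineMap_apply_zero, sub_zero, div_one] at hslope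
  linarith

/-- A gradient flow of a differentiable convex function that stays in a closed set converges to the
minimizer of the function if no other point of that set attains the minimum. -/
theorem tendsto_of_gradient_flow {E : Type*} [NormedAddCommGroup E] [InnerProductSpace ℝ E]
    [FiniteDimensional ℝ E] {F : E → ℝ} (hF : ConvexOn ℝ Set.univ F) (hd : Differentiable ℝ F)
    {K : Set E} (hK : IsClosed K) {q : E} (hmin : ∀ x, F q ≤ F x)
    (huniq : ∀ x ∈ K, F x ≤ F q → x = q) {p : ℝ → E} (hp : ∀ t, 0 ≤ t → p t ∈ K)
    (hode : ∀ t, 0 ≤ t → HasDerivAt p (-gradient F (p t)) t) :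
    Tendsto p atTop (nhds q) := by
  have hD : ∀ t, 0 ≤ t → HasDerivAt (fun t => ‖p t - q‖ ^ 2)
      (2 * inner ℝ (p t - q) (-gradient F (p t))) t := fun t ht =>
    ((hode t ht).sub_const q).norm_sq
  have hle : ∀ t, 2 * inner ℝ (p t - q) (-gradient F (p t)) ≤ -2 * (F (p t) - F q) := by
    intro t
    have := hF.sub_le_inner_gradient (hd (p t)) q
    rw [inner_neg_right]
    linarith
  have hanti_of : ∀ δ : ℝ, (∀ t, 0 ≤ t → δ ≤ F (p t) - F q) →
      AntitoneOn (fun t => ‖p t - q‖ ^ 2 + 2 * δ * t) (Set.Ici 0) := by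
    intro δ hδ
    have hderiv : ∀ t, 0 ≤ t → HasDerivAt (fun t => ‖p t - q‖ ^ 2 + 2 * δ * t)
        (2 * inner ℝ (p t - q) (-gradient F (p t)) + 2 * δ) t := fun t ht => by
      have hlin : HasDerivAt (fun t : ℝ => 2 * δ * t) (2 * δ) t := by
        simpa using (hasDerivAt_id t).const_mul (2 * δ)
      exact (hD t ht).add hlin
    refine antitoneOn_of_deriv_nonpos (convex_Ici 0)
      (fun t ht => (hderiv t ht).continuousAt.continuousWithinAt)
      (fun t ht => (hderiv t (interior_subset ht)).differentiableAt.differentiableWithinAt)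
      fun t ht => ?_
    rw [(hderiv t (interior_subset ht)).deriv]
    linarith [hle t, hδ t (interior_subset ht)]
  have hanti : ∀ s t, 0 ≤ s → s ≤ t → ‖p t - q‖ ≤ ‖p s - q‖ := by
    intro s t hs hst
    have := hanti_of 0 (fun t _ => sub_nonneg.2 (hmin _)) hs (hs.trans hst) hst
    exact le_of_sq_le_sq (by simpa using this) (norm_nonneg _)
  rw [Metric.tendsto_atTop]
  intro ε hε
  suffices h : ∃ T, 0 ≤ T ∧ ‖p T - q‖ < ε by
    obtain ⟨T, hT, hTε⟩ := h
    exact ⟨T, fun t ht => by rw [dist_eq_norm]; exact (hanti T t hT ht).trans_lt hTε⟩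
  by_contra! hfar
  have hcompact : IsCompact (K ∩ Metric.closedBall q ‖p 0 - q‖ ∩ (Metric.ball q ε)ᶜ) :=
    ((isCompact_closedBall q _).inter_left hK).inter_right Metric.isOpen_ball.isClosed_compl
  have hmem : ∀ t, 0 ≤ t → p t ∈ K ∩ Metric.closedBall q ‖p 0 - q‖ ∩ (Metric.ball q ε)ᶜ :=
    fun t ht => ⟨⟨hp t ht, by simpa [dist_eq_norm] using hanti 0 t le_rfl ht⟩,
      by simpa [dist_eq_norm] using hfar t ht⟩
  obtain ⟨m, ⟨⟨hmK, -⟩, hmε⟩, hm⟩ :=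
    hcompact.exists_isMinOn ⟨_, hmem 0 le_rfl⟩ hd.continuous.continuousOn
  have hδ : 0 < F m - F q := by
    by_contra! h
    rw [huniq m hmK (by linarith)] at hmε
    exact hmε (Metric.mem_ball_self hε)
  have hdecay := hanti_of (F m - F q) fun t ht => sub_le_sub_right (hm (hmem t ht)) _
  set δ := F m - F q
  set T := (‖p 0 - q‖ ^ 2 + 1) / (2 * δ) with hTdef
  have hT : 0 ≤ T := by positivity
  have h := hdecay (Set.mem_Ici.2 le_rfl) hT hT
  have hmul : 2 * δ * T = ‖p 0 - q‖ ^ 2 + 1 := by rw [hTdef]; field_simp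
  simp only [hmul] at h
  nlinarith [sq_nonneg ‖p T - q‖]

section NormIntegral

variable {E V : Type*} [NormedAddCommGroup E] [NormedSpace ℝ E]
  [NormedAddCommGroup V] [InnerProductSpace ℝ V] (T : E →L[ℝ] V) (e : V) {μ : Measure ℝ}

theorem integrable_norm_sub_smul [IsFiniteMeasure μ] (hμ : Integrable (fun x : ℝ => x) μ) (q : E) :
    Integrable (fun x : ℝ => ‖T q - x • e‖) μ :=
  ((integrable_const (T q)).sub (hμ.smul_const e)).norm

theorem convexOn_integral_norm_sub_smul [IsFiniteMeasure μ]
    (hμ : Integrable (fun x : ℝ => x) μ) :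
    ConvexOn ℝ Set.univ (fun q => ∫ x, ‖T q - x • e‖ ∂μ) := by
  refine ⟨convex_univ, fun q _ r _ s t hs ht hst => ?_⟩
  have hq := integrable_norm_sub_smul T e hμ q
  have hr := integrable_norm_sub_smul T e hμ r
  simp only [smul_eq_mul]
  rw [← integral_const_mul, ← integral_const_mul, ← integral_add (hq.const_mul s) (hr.const_mul t)]
  refine integral_mono (integrable_norm_sub_smul T e hμ _) ((hq.const_mul s).add (hr.const_mul t))
    fun x => ?_
  have heq : T (s • q + t • r) - x • e = s • (T q - x • e) + t • (T r - x • e) := by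
    obtain rfl : t = 1 - s := by linarith
    simp only [map_add, map_smul]
    module
  simp only [heq]
  simpa [norm_smul, abs_of_nonneg hs, abs_of_nonneg ht] using
    norm_add_le (s • (T q - x • e)) (t • (T r - x • e))

theorem integral_norm_sub_smul_midpoint_lt [IsFiniteMeasure μ] [NeZero μ]
    (hμ : Integrable (fun x : ℝ => x) μ) {q r : E}
    (hqr : ∀ᵐ x ∂μ, ¬SameRay ℝ (T q - x • e) (T r - x • e)) :
    2 * ∫ x, ‖T (midpoint ℝ q r) - x • e‖ ∂μ <
      (∫ x, ‖T q - x • e‖ ∂μ) + ∫ x, ‖T r - x • e‖ ∂μ := by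
  have hq := integrable_norm_sub_smul T e hμ q
  have hr := integrable_norm_sub_smul T e hμ r
  have hm := integrable_norm_sub_smul T e hμ (midpoint ℝ q r)
  have hlt : ∀ᵐ x ∂μ, 2 * ‖T (midpoint ℝ q r) - x • e‖ < ‖T q - x • e‖ + ‖T r - x • e‖ := by
    filter_upwards [hqr] with x hx
    have heq : (2 : ℝ) • (T (midpoint ℝ q r) - x • e) = (T q - x • e) + (T r - x • e) := by
      rw [midpoint_eq_smul_add, map_smul, map_add, invOf_eq_inv]
      module
    calc 2 * ‖T (midpoint ℝ q r) - x • e‖ = ‖(T q - x • e) + (T r - x • e)‖ := by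
          rw [← heq, norm_smul]; simp
      _ < _ := norm_add_lt_of_not_sameRay hx
  rw [← integral_const_mul, ← integral_add hq hr]
  refine lt_of_le_of_ne (integral_mono_ae (hm.const_mul 2) (hq.add hr) (hlt.mono fun x h => h.le))
    fun heq => ?_
  have hae := (integral_eq_iff_of_ae_le (hm.const_mul 2) (hq.add hr)
    (hlt.mono fun x h => h.le)).1 heq
  obtain ⟨x, hx, hx'⟩ := (hlt.and hae).exists
  exact hx.ne hx'

theorem differentiable_integral_norm_sub_smul [FiniteDimensional ℝ E] [IsFiniteMeasure μ]
    [NullSingletonClass μ] (hμ : Integrable (fun x : ℝ => x) μ) (he : e ≠ 0) :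
    Differentiable ℝ (fun q => ∫ x, ‖T q - x • e‖ ∂μ) := by
  intro q
  have hne : ∀ᵐ x ∂μ, T q - x • e ≠ 0 := by
    have hsub : {x : ℝ | T q - x • e = 0}.Subsingleton := fun x hx y hy =>
      smul_left_injective ℝ he ((sub_eq_zero.1 hx).symm.trans (sub_eq_zero.1 hy))
    exact measure_eq_zero_iff_ae_notMem.1 (hsub.measure_zero μ)
  have hcont : Continuous (Function.uncurry fun (x : ℝ) (r : E) => ‖T r - x • e‖) := by
    unfold Function.uncurry
    fun_prop
  have : ProperSpace E := FiniteDimensional.proper ℝ E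
  borelize E
  refine (hasFDerivAt_integral_of_dominated_loc_of_lip (F := fun r x => ‖T r - x • e‖)
    (F' := fun x => fderiv ℝ (fun r => ‖T r - x • e‖) q) (bound := fun _ => ‖T‖) univ_mem
    (Eventually.of_forall fun r => (integrable_norm_sub_smul T e hμ r).aestronglyMeasurable)
    (integrable_norm_sub_smul T e hμ q)
    ((measurable_fderiv_with_param ℝ hcont).comp
      (measurable_id.prodMk measurable_const)).aestronglyMeasurable
    (Eventually.of_forall fun x => LipschitzOnWith.of_dist_le_mul fun r _ s _ => ?_)
    (integrable_const _) ?_).2.differentiableAt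
  · rw [dist_eq_norm, dist_eq_norm, Real.coe_nnabs, abs_of_nonneg (norm_nonneg T)]
    refine (abs_norm_sub_norm_le _ _).trans ?_
    rw [sub_sub_sub_cancel_right, ← map_sub]
    exact T.le_opNorm _
  · filter_upwards [hne] with x hx
    exact ((T.differentiableAt.sub_const _).norm ℝ hx).hasFDerivAt

end NormIntegral

section ExpectedCost

/-- The linear map `(X, Y) ↦ (√b X, Y)`. -/
noncomputable def horizontalScaling (b : ℝ) :
    EuclideanSpace ℝ (Fin 2) →L[ℝ] EuclideanSpace ℝ (Fin 2) :=
  Matrix.toEuclideanCLM (𝕜 := ℝ) (Matrix.diagonal ![√b, 1])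

theorem horizontalScaling_apply_zero (b : ℝ) (q : EuclideanSpace ℝ (Fin 2)) :
    horizontalScaling b q 0 = √b * q 0 := by
  simp [horizontalScaling, Matrix.ofLp_toEuclideanCLM, Matrix.mulVec_diagonal]

theorem horizontalScaling_apply_one (b : ℝ) (q : EuclideanSpace ℝ (Fin 2)) :
    horizontalScaling b q 1 = q 1 := by
  simp [horizontalScaling, Matrix.ofLp_toEuclideanCLM, Matrix.mulVec_diagonal]

theorem horizontalScaling_injective {b : ℝ} (hb : 0 < b) :
    Function.Injective (horizontalScaling b) := by
  intro q r h
  have h0 := congrArg (fun v : EuclideanSpace ℝ (Fin 2) => v 0) h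
  have h1 := congrArg (fun v : EuclideanSpace ℝ (Fin 2) => v 1) h
  simp only [horizontalScaling_apply_zero, horizontalScaling_apply_one] at h0 h1
  ext i
  fin_cases i
  · exact mul_left_cancel₀ (sqrt_pos.2 hb).ne' h0
  · exact h1

theorem norm_horizontalScaling_sub {b : ℝ} (hb : 0 ≤ b) (q : EuclideanSpace ℝ (Fin 2)) (x : ℝ) :
    ‖horizontalScaling b q - x • EuclideanSpace.single (0 : Fin 2) √b‖ =
      √(b * (q 0 - x) ^ 2 + q 1 ^ 2) := by
  rw [EuclideanSpace.norm_eq]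
  simp only [Fin.sum_univ_two, PiLp.sub_apply, PiLp.smul_apply, horizontalScaling_apply_zero,
    horizontalScaling_apply_one, PiLp.single_apply, norm_eq_abs, sq_abs, smul_eq_mul]
  congr 1
  simp only [if_true, one_ne_zero, if_false, mul_zero, sub_zero]
  linear_combination (q 0 - x) ^ 2 * sq_sqrt hb

theorem subsingleton_sameRay_horizontalScaling {b : ℝ} (hb : 0 < b)
    {q r : EuclideanSpace ℝ (Fin 2)} (hqr : q ≠ r) (hq : q 1 ≠ 0) :
    {x : ℝ | SameRay ℝ (horizontalScaling b q - x • EuclideanSpace.single (0 : Fin 2) √b)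
      (horizontalScaling b r - x • EuclideanSpace.single (0 : Fin 2) √b)}.Subsingleton := by
  have hdet : ∀ u v : EuclideanSpace ℝ (Fin 2), SameRay ℝ u v → u 0 * v 1 = u 1 * v 0 := by
    rintro u v (rfl | rfl | ⟨s, t, hs, ht, h⟩)
    · simp
    · simp
    · have h0 : s * u 0 = t * v 0 := congrArg (fun w : EuclideanSpace ℝ (Fin 2) => w 0) h
      have h1 : s * u 1 = t * v 1 := congrArg (fun w : EuclideanSpace ℝ (Fin 2) => w 1) h
      refine mul_left_cancel₀ hs.ne' (mul_left_cancel₀ ht.ne' ?_)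
      linear_combination t * v 1 * h0 - t * v 0 * h1
  have hlin : ∀ x : ℝ,
      SameRay ℝ (horizontalScaling b q - x • EuclideanSpace.single (0 : Fin 2) √b)
        (horizontalScaling b r - x • EuclideanSpace.single (0 : Fin 2) √b) →
      (q 0 - x) * r 1 = q 1 * (r 0 - x) := by
    intro x hx
    have h := hdet _ _ hx
    simp only [PiLp.sub_apply, PiLp.smul_apply, horizontalScaling_apply_zero,
      horizontalScaling_apply_one, PiLp.single_apply, smul_eq_mul, if_true,
      one_ne_zero, if_false, mul_zero, sub_zero] at h
    refine mul_left_cancel₀ (sqrt_pos.2 hb).ne' ?_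
    linear_combination h
  intro x hx y hy
  by_contra hxy
  have h1 : q 1 = r 1 := by
    refine mul_left_cancel₀ (sub_ne_zero.2 hxy) ?_
    linear_combination hlin x hx - hlin y hy
  have h0 : q 0 = r 0 := by
    refine mul_left_cancel₀ hq ?_
    linear_combination hlin x hx + (q 0 - x) * h1
  apply hqr
  ext i
  fin_cases i
  exacts [h0, h1]

/-- The average over `μ` of `a √(b (X - x) ^ 2 + Y ^ 2)`, minus `c Y`. -/
noncomputable def expectedCost (μ : Measure ℝ) (a b c : ℝ) (q : EuclideanSpace ℝ (Fin 2)) : ℝ :=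
  a * (∫ x, ‖horizontalScaling b q - x • EuclideanSpace.single (0 : Fin 2) √b‖ ∂μ) - c * q 1

theorem expectedCost_reflection {μ : Measure ℝ} {a b c : ℝ} (hb : 0 ≤ b)
    {q r : EuclideanSpace ℝ (Fin 2)}
    (h0 : r 0 = q 0) (h1 : r 1 = -q 1) :
    expectedCost μ a b c r = expectedCost μ a b c q + 2 * c * q 1 := by
  simp only [expectedCost, norm_horizontalScaling_sub hb, h0, h1, neg_sq]
  ring

variable {μ : Measure ℝ} [IsProbabilityMeasure μ] {a b c : ℝ}

theorem convexOn_expectedCost (hμ : Integrable (fun x : ℝ => x) μ) (ha : 0 ≤ a) :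
    ConvexOn ℝ Set.univ (expectedCost μ a b c) :=
  ((convexOn_integral_norm_sub_smul (horizontalScaling b) _ hμ).smul ha).sub
    ((c • EuclideanSpace.proj (𝕜 := ℝ) (1 : Fin 2)).toLinearMap.concaveOn convex_univ)

theorem differentiable_expectedCost [NullSingletonClass μ] (hμ : Integrable (fun x : ℝ => x) μ)
    (hb : 0 < b) : Differentiable ℝ (expectedCost μ a b c) :=
  ((differentiable_integral_norm_sub_smul (horizontalScaling b) _ hμ
    (by simpa using (sqrt_pos.2 hb).ne')).const_mul a).sub
    ((EuclideanSpace.proj (𝕜 := ℝ) (1 : Fin 2)).differentiable.const_mul c)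

theorem tendsto_expectedCost_cocompact (hμ : Integrable (fun x : ℝ => x) μ)
    (hb : 0 < b) (hc : 0 ≤ c) (hca : c < a) :
    Tendsto (expectedCost μ a b c) (cocompact _) atTop := by
  set e : EuclideanSpace ℝ (Fin 2) := EuclideanSpace.single 0 √b with he
  have hnorm : Tendsto (fun q => ‖horizontalScaling b q‖) (cocompact _) atTop :=
    tendsto_norm_cocompact_atTop.comp
      (LinearMap.isClosedEmbedding_of_injective (f := (horizontalScaling b).toLinearMap)
        (LinearMap.ker_eq_bot.2 (horizontalScaling_injective hb))).tendsto_cocompact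
  refine tendsto_atTop_mono (fun q => ?_) ((tendsto_atTop_add_const_right _
    (-((∫ x, |x| ∂μ) * ‖e‖)) hnorm).const_mul_atTop (sub_pos.2 hca))
  have hint := integrable_norm_sub_smul (horizontalScaling b) e hμ q
  have hlow : ‖horizontalScaling b q‖ - (∫ x, |x| ∂μ) * ‖e‖ ≤
      ∫ x, ‖horizontalScaling b q - x • e‖ ∂μ := by
    calc _ = ∫ x, (‖horizontalScaling b q‖ - |x| * ‖e‖) ∂μ := by
          rw [integral_sub (integrable_const _) (hμ.abs.mul_const _), integral_mul_const]
          simp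
      _ ≤ _ := integral_mono ((integrable_const _).sub (hμ.abs.mul_const _)) hint fun x => by
          simpa [norm_smul] using norm_sub_norm_le (horizontalScaling b q) (x • e)
  have hcoord : q 1 ≤ ∫ x, ‖horizontalScaling b q - x • e‖ ∂μ := by
    calc q 1 = ∫ _, q 1 ∂μ := by simp
      _ ≤ _ := integral_mono (integrable_const _) hint fun x => by
          have h := PiLp.norm_apply_le (horizontalScaling b q - x • e) 1
          simp only [PiLp.sub_apply, PiLp.smul_apply, horizontalScaling_apply_one, he,
            PiLp.single_apply, one_ne_zero, if_false, smul_zero, sub_zero] at h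
          exact (le_abs_self _).trans h
  have h1 := mul_le_mul_of_nonneg_left hlow (sub_pos.2 hca).le
  have h2 := mul_le_mul_of_nonneg_left hcoord hc
  unfold expectedCost
  rw [← he]
  linarith

theorem apply_one_pos_of_forall_expectedCost_le [NullSingletonClass μ]
    (hμ : Integrable (fun x : ℝ => x) μ) (hb : 0 < b) (hc : 0 < c)
    {q : EuclideanSpace ℝ (Fin 2)}
    (hq : ∀ r, expectedCost μ a b c q ≤ expectedCost μ a b c r) : 0 < q 1 := by
  refine lt_of_le_of_ne ?_ fun h => ?_
  · have h := hq !₂[q 0, -q 1]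
    rw [expectedCost_reflection (q := q) (r := !₂[q 0, -q 1]) hb.le (by simp) (by simp)] at h
    exact nonneg_of_mul_nonneg_right (by linarith : 0 ≤ 2 * c * q 1) (by positivity)
  · set u : EuclideanSpace ℝ (Fin 2) := EuclideanSpace.single 1 1
    have hline : ∀ k : ℝ, HasDerivAt (fun s : ℝ => q + (k * s) • u) (k • u) 0 := fun k => by
      simpa using (((hasDerivAt_id (0 : ℝ)).const_mul k).smul_const u).const_add q
    have hmin : ∀ k : ℝ, HasDerivAt (fun s : ℝ => expectedCost μ a b c (q + (k * s) • u)) 0 0 := by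
      intro k
      have hd : HasFDerivAt (expectedCost μ a b c)
          (0 : EuclideanSpace ℝ (Fin 2) →L[ℝ] ℝ) (q + (k * 0) • u) := by
        have hloc : IsLocalMin (expectedCost μ a b c) q := Eventually.of_forall hq
        have hfd := (differentiable_expectedCost (a := a) (c := c) hμ hb q).hasFDerivAt
        rw [hloc.fderiv_eq_zero] at hfd
        simpa using hfd
      exact hd.comp_hasDerivAt (0 : ℝ) (hline k)
    have hrefl : (fun s : ℝ => expectedCost μ a b c (q + (-1 * s) • u)) =
        fun s => expectedCost μ a b c (q + (1 * s) • u) + 2 * c * s := by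
      ext s
      rw [expectedCost_reflection (q := q + (1 * s) • u) hb.le (by simp [u]) (by simp [u, ← h])]
      simp [u, ← h]
    have hsum := (hmin 1).add ((hasDerivAt_id (0 : ℝ)).const_mul (2 * c))
    have huniq := (hmin (-1)).unique (by rw [hrefl]; exact hsum)
    simp at huniq
    exact hc.ne' huniq

theorem eq_of_expectedCost_le [NullSingletonClass μ]
    (hμ : Integrable (fun x : ℝ => x) μ) (ha : 0 < a) (hb : 0 < b) (hc : 0 < c)
    {q r : EuclideanSpace ℝ (Fin 2)}
    (hq : ∀ r, expectedCost μ a b c q ≤ expectedCost μ a b c r)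
    (hr : expectedCost μ a b c r ≤ expectedCost μ a b c q) : r = q := by
  by_contra hne
  have hpos := apply_one_pos_of_forall_expectedCost_le hμ hb hc hq
  have hlt := integral_norm_sub_smul_midpoint_lt (horizontalScaling b) _ hμ
    (measure_eq_zero_iff_ae_notMem.1
      ((subsingleton_sameRay_horizontalScaling hb (Ne.symm hne) hpos.ne').measure_zero μ))
  have hmid := hq (midpoint ℝ q r)
  have hcoord : midpoint ℝ q r 1 = (q 1 + r 1) / 2 := by
    simp [midpoint_eq_smul_add]
    ring
  have := mul_lt_mul_of_pos_left hlt ha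
  simp only [expectedCost, hcoord] at hr hmid
  linarith

end ExpectedCost

/-- A gradient-descent trajectory of `C_exp` that stays in the open upper half plane
converges to the unique global minimizer of `C_exp` over ℝ × [0,∞). -/
theorem stmt_8
    (W M a b c : ℝ) (φ : ℝ → ℝ)
    (hW : 0 < W) (hM : 0 < M) (hφm : Measurable φ)
    (hφ0 : ∀ x, 0 ≤ φ x) (hφM : ∀ x, φ x ≤ M)
    (hφs : ∀ x, x ∉ Set.Icc (0:ℝ) W → φ x = 0)
    (hφ1 : (∫ x in (0:ℝ)..W, φ x) = 1)
    (hb : 0 < b) (hc : 0 < c) (hca : c < a)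
    (Cexp : ℝ → ℝ → ℝ)
    (hCexp : ∀ X Y : ℝ, Cexp X Y =
      ∫ x in (0:ℝ)..W, (a * Real.sqrt (b * (X - x) ^ 2 + Y ^ 2) - c * Y) * φ x)
    (p : ℝ → EuclideanSpace ℝ (Fin 2))
    (hppos : ∀ t : ℝ, 0 ≤ t → 0 < p t 1)
    (hode : ∀ t : ℝ, 0 ≤ t →
      HasDerivAt p
        (-(gradient (fun q : EuclideanSpace ℝ (Fin 2) => Cexp (q 0) (q 1)) (p t))) t) :
    ∃ q : EuclideanSpace ℝ (Fin 2), 0 ≤ q 1 ∧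
      (∀ X Y : ℝ, 0 ≤ Y → Cexp (q 0) (q 1) ≤ Cexp X Y) ∧
      (∀ q' : EuclideanSpace ℝ (Fin 2), 0 ≤ q' 1 →
        (∀ X Y : ℝ, 0 ≤ Y → Cexp (q' 0) (q' 1) ≤ Cexp X Y) → q' = q) ∧
      Tendsto p atTop (nhds q) := by
  have hφint : IntervalIntegrable φ volume 0 W := by
    by_contra h
    rw [intervalIntegral.integral_undef h] at hφ1
    exact zero_ne_one hφ1
  have hφint' : Integrable φ (volume.restrict (Set.Ioc 0 W)) :=
    (intervalIntegrable_iff_integrableOn_Ioc_of_le hW.le).1 hφint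
  set μ : Measure ℝ := (volume.restrict (Set.Ioc 0 W)).withDensity fun x => ENNReal.ofReal (φ x)
    with hμdef
  have hμ_integral : ∀ g : ℝ → ℝ, ∫ x, g x ∂μ = ∫ x in (0:ℝ)..W, g x * φ x := by
    intro g
    rw [hμdef, integral_withDensity_eq_integral_toReal_smul hφm.ennreal_ofReal
      (Eventually.of_forall fun _ => ENNReal.ofReal_lt_top),
      intervalIntegral.integral_of_le hW.le]
    simp [ENNReal.toReal_ofReal, hφ0, mul_comm]
  have : IsProbabilityMeasure μ := by
    constructor
    rw [hμdef, withDensity_apply _ MeasurableSet.univ, Measure.restrict_univ,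
      ← ofReal_integral_eq_lintegral_ofReal hφint' (Eventually.of_forall hφ0),
      ← intervalIntegral.integral_of_le hW.le, hφ1, ENNReal.ofReal_one]
  have hac : μ ≪ volume.restrict (Set.Ioc 0 W) := withDensity_absolutelyContinuous _ _
  have : NullSingletonClass μ := ⟨fun x => hac (measure_singleton x)⟩
  have hμ : Integrable (fun x : ℝ => x) μ := by
    refine Integrable.of_bound measurable_id.aestronglyMeasurable W (hac.ae_le ?_)
    filter_upwards [ae_restrict_mem measurableSet_Ioc] with x hx
    rw [norm_eq_abs, abs_of_pos hx.1]
    exact hx.2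
  have hcost : ∀ q : EuclideanSpace ℝ (Fin 2), Cexp (q 0) (q 1) = expectedCost μ a b c q := by
    intro q
    have hint := integrable_norm_sub_smul (horizontalScaling b)
      (EuclideanSpace.single (0 : Fin 2) √b) hμ q
    rw [hCexp, ← hμ_integral, expectedCost]
    simp only [← norm_horizontalScaling_sub hb.le]
    rw [integral_sub (hint.const_mul a) (integrable_const _), integral_const_mul]
    simp
  have ha : 0 < a := hc.trans hca
  have hd := differentiable_expectedCost (a := a) (c := c) hμ hb
  obtain ⟨q, hq⟩ :=
    hd.continuous.exists_forall_le (tendsto_expectedCost_cocompact hμ hb hc.le hca)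
  have hq1 := apply_one_pos_of_forall_expectedCost_le hμ hb hc hq
  have hqmin : ∀ X Y : ℝ, Cexp (q 0) (q 1) ≤ Cexp X Y := fun X Y => by
    simpa [← hcost] using hq !₂[X, Y]
  refine ⟨q, hq1.le, fun X Y _ => hqmin X Y, fun q' _ hmin => ?_, ?_⟩
  · refine eq_of_expectedCost_le hμ ha hb hc hq ?_
    rw [← hcost, ← hcost]
    exact hmin _ _ hq1.le
  · simp only [hcost] at hode
    exact tendsto_of_gradient_flow (convexOn_expectedCost hμ ha.le) hd
      (K := {x | 0 ≤ x 1}) (isClosed_le continuous_const (by fun_prop)) hq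
      (fun x _ hx => eq_of_expectedCost_le hμ ha hb hc hq hx) (fun t ht => (hppos t ht).le) hode
end

section
/- Define the expected constrained travel time T_exp(X,Y) := ∫₀^W T(X,Y,x) φ(x) dx, where T(X,Y,x) := (√((1−v²)(X−x)² + Y²) − vY)/(1−v²). Then T_exp attains a global minimum over ℝ × [0,∞) at a unique point (X*,Y*), and this point satisfies 0 < X* < W and Y* > 0. -/
open Real MeasureTheory Filter

/-- Minimum time for a unit-speed vehicle at `(X, Y)` to intercept a target that starts at
`(x, 0)` and moves with velocity `(0, v)`. -/
noncomputable def interceptTime (v X Y x : ℝ) : ℝ :=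
  (√((1 - v ^ 2) * (X - x) ^ 2 + Y ^ 2) - v * Y) / (1 - v ^ 2)

/-- The expected interception time when the starting abscissa has law `μ`. -/
noncomputable def expectedTime (μ : Measure ℝ) (v X Y : ℝ) : ℝ :=
  ∫ x, interceptTime v X Y x ∂μ

section Pointwise

variable {v : ℝ}

lemma one_sub_sq_pos_of_lt_one (hv0 : 0 < v) (hv1 : v < 1) : 0 < 1 - v ^ 2 := by nlinarith

lemma continuous_interceptTime (v : ℝ) :
    Continuous fun p : (ℝ × ℝ) × ℝ => interceptTime v p.1.1 p.1.2 p.2 := by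
  unfold interceptTime
  fun_prop

lemma abs_sub_le_interceptTime (hv0 : 0 < v) (hv1 : v < 1) (X Y x : ℝ) :
    |X - x| ≤ interceptTime v X Y x := by
  have hk := one_sub_sq_pos_of_lt_one hv0 hv1
  rw [interceptTime, le_div_iff₀ hk]
  have h : |X - x| * (1 - v ^ 2) + v * Y ≤ √((1 - v ^ 2) * (X - x) ^ 2 + Y ^ 2) := by
    apply Real.le_sqrt_of_sq_le
    rw [← sq_abs (X - x)]
    nlinarith [mul_nonneg hk.le (sq_nonneg (v * |X - x| - Y))]
  linarith

lemma half_le_interceptTime (hv0 : 0 < v) (hv1 : v < 1) {Y : ℝ} (hY : 0 ≤ Y) (X x : ℝ) :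
    Y / 2 ≤ interceptTime v X Y x := by
  have hk := one_sub_sq_pos_of_lt_one hv0 hv1
  rw [interceptTime, le_div_iff₀ hk]
  have h : Y ≤ √((1 - v ^ 2) * (X - x) ^ 2 + Y ^ 2) := by
    apply Real.le_sqrt_of_sq_le
    nlinarith [mul_nonneg hk.le (sq_nonneg (X - x))]
  nlinarith [mul_nonneg hY (sq_nonneg (1 - v))]

lemma interceptTime_midpoint_lt (hv0 : 0 < v) (hv1 : v < 1) {X Y X' Y' x : ℝ}
    (hY : 0 < Y) (hY' : 0 < Y') (h : (X - x) * Y' ≠ (X' - x) * Y) :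
    interceptTime v ((X + X') / 2) ((Y + Y') / 2) x <
      (interceptTime v X Y x + interceptTime v X' Y' x) / 2 := by
  have hk := one_sub_sq_pos_of_lt_one hv0 hv1
  unfold interceptTime
  set k := 1 - v ^ 2
  set a := X - x
  set b := X' - x
  have hS : 0 < √(k * a ^ 2 + Y ^ 2) := by positivity
  have hS' : 0 < √(k * b ^ 2 + Y' ^ 2) := by positivity
  have e : (X + X') / 2 - x = (a + b) / 2 := by simp only [a, b]; ring
  rw [e]
  have hsq := Real.sq_sqrt (show 0 ≤ k * a ^ 2 + Y ^ 2 by positivity)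
  have hsq' := Real.sq_sqrt (show 0 ≤ k * b ^ 2 + Y' ^ 2 by positivity)
  have hcs : k * a * b + Y * Y' < √(k * a ^ 2 + Y ^ 2) * √(k * b ^ 2 + Y' ^ 2) := by
    refine lt_of_pow_lt_pow_left₀ 2 (by positivity) ?_
    rw [mul_pow, hsq, hsq']
    have : 0 < k * (a * Y' - b * Y) ^ 2 := by
      have : a * Y' - b * Y ≠ 0 := sub_ne_zero.2 h
      positivity
    nlinarith
  have hmid : √(k * ((a + b) / 2) ^ 2 + ((Y + Y') / 2) ^ 2) <
      (√(k * a ^ 2 + Y ^ 2) + √(k * b ^ 2 + Y' ^ 2)) / 2 := by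
    rw [Real.sqrt_lt' (by positivity)]
    nlinarith
  rw [← add_div, div_div, mul_comm k 2, ← div_div, div_lt_div_iff_of_pos_right hk]
  linarith

lemma interceptTime_add_le (hv0 : 0 < v) (hv1 : v < 1) (X x t : ℝ) {Y : ℝ} (hY : 0 < Y) :
    interceptTime v (X + t) Y x ≤ interceptTime v X Y x +
      (t ^ 2 / 2 * (1 / √((1 - v ^ 2) * (X - x) ^ 2 + Y ^ 2)) +
        t * ((X - x) / √((1 - v ^ 2) * (X - x) ^ 2 + Y ^ 2))) := by
  have hk := one_sub_sq_pos_of_lt_one hv0 hv1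
  unfold interceptTime
  set k := 1 - v ^ 2
  have hS : 0 < √(k * (X - x) ^ 2 + Y ^ 2) := by positivity
  have hsq := Real.sq_sqrt (show 0 ≤ k * (X - x) ^ 2 + Y ^ 2 by positivity)
  have hsq' := Real.sq_sqrt (show 0 ≤ k * (X + t - x) ^ 2 + Y ^ 2 by positivity)
  set S := √(k * (X - x) ^ 2 + Y ^ 2)
  set S' := √(k * (X + t - x) ^ 2 + Y ^ 2)
  have h : S' ≤ S + k * (t ^ 2 + 2 * t * (X - x)) / (2 * S) := by
    rw [← sub_le_iff_le_add', le_div_iff₀ (by positivity)]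
    nlinarith [sq_nonneg (S' - S)]
  calc (S' - v * Y) / k ≤ (S + k * (t ^ 2 + 2 * t * (X - x)) / (2 * S) - v * Y) / k := by gcongr
    _ = _ := by field_simp; ring

end Pointwise

section Expected

variable {μ : Measure ℝ} {W v : ℝ}

lemma ae_mem_Ioo_of_ae_mem_Icc [NullSingletonClass μ] (hμ : ∀ᵐ x ∂μ, x ∈ Set.Icc 0 W) :
    ∀ᵐ x ∂μ, x ∈ Set.Ioo 0 W := by
  filter_upwards [hμ, μ.ae_ne 0, μ.ae_ne W] with x hx h0 hW
  exact ⟨lt_of_le_of_ne hx.1 h0.symm, lt_of_le_of_ne hx.2 hW⟩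

lemma Continuous.integrable_of_ae_mem_Icc [IsFiniteMeasure μ] (hμ : ∀ᵐ x ∂μ, x ∈ Set.Icc 0 W)
    {f : ℝ → ℝ} (hf : Continuous f) : Integrable f μ := by
  rw [← Measure.restrict_eq_self_of_ae_mem hμ]
  exact hf.continuousOn.integrableOn_compact isCompact_Icc

lemma integrable_interceptTime [IsFiniteMeasure μ] (hμ : ∀ᵐ x ∂μ, x ∈ Set.Icc 0 W)
    (v X Y : ℝ) : Integrable (interceptTime v X Y) μ :=
  ((continuous_interceptTime v).comp
    (Continuous.prodMk_right (X, Y))).integrable_of_ae_mem_Icc hμ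

lemma integral_lt_integral_of_ae_lt [NeZero μ] {f g : ℝ → ℝ} (hf : Integrable f μ)
    (hg : Integrable g μ) (h : ∀ᵐ x ∂μ, f x < g x) : ∫ x, f x ∂μ < ∫ x, g x ∂μ := by
  refine lt_of_le_of_ne (integral_mono_ae hf hg (h.mono fun _ => le_of_lt)) fun heq => ?_
  have := (integral_eq_iff_of_ae_le hf hg (h.mono fun _ => le_of_lt)).1 heq
  obtain ⟨x, hx, hx'⟩ := (h.and this).exists
  exact hx.ne hx'

lemma continuous_expectedTime [IsFiniteMeasure μ] (hμ : ∀ᵐ x ∂μ, x ∈ Set.Icc 0 W) :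
    Continuous fun p : ℝ × ℝ => expectedTime μ v p.1 p.2 := by
  unfold expectedTime
  rw [← Measure.restrict_eq_self_of_ae_mem hμ]
  exact continuous_parametric_integral_of_continuous (continuous_interceptTime v) isCompact_Icc

lemma abs_sub_le_expectedTime [IsProbabilityMeasure μ] (hμ : ∀ᵐ x ∂μ, x ∈ Set.Icc 0 W)
    (hv0 : 0 < v) (hv1 : v < 1) (X Y : ℝ) : |X| - W ≤ expectedTime μ v X Y := by
  have h : ∫ _, (|X| - W) ∂μ ≤ expectedTime μ v X Y := by
    refine integral_mono_ae (integrable_const _) (integrable_interceptTime hμ v X Y) ?_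
    filter_upwards [hμ] with x hx
    have h1 := abs_sub_le_interceptTime hv0 hv1 X Y x
    have h2 := abs_sub_abs_le_abs_sub X x
    rw [abs_of_nonneg hx.1] at h2
    linarith [hx.2]
  simpa using h

lemma half_le_expectedTime [IsProbabilityMeasure μ] (hμ : ∀ᵐ x ∂μ, x ∈ Set.Icc 0 W)
    (hv0 : 0 < v) (hv1 : v < 1) (X : ℝ) {Y : ℝ} (hY : 0 ≤ Y) :
    Y / 2 ≤ expectedTime μ v X Y := by
  have h : ∫ _, Y / 2 ∂μ ≤ expectedTime μ v X Y :=
    integral_mono (integrable_const _) (integrable_interceptTime hμ v X Y)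
      fun x => half_le_interceptTime hv0 hv1 hY X x
  simpa using h

/-- `(X, Y)` minimises the expected interception time over the closed upper half-plane. -/
def IsMinimizer (μ : Measure ℝ) (v X Y : ℝ) : Prop :=
  0 ≤ Y ∧ ∀ X' Y' : ℝ, 0 ≤ Y' → expectedTime μ v X Y ≤ expectedTime μ v X' Y'

lemma exists_isMinimizer [IsProbabilityMeasure μ] (hμ : ∀ᵐ x ∂μ, x ∈ Set.Icc 0 W)
    (hW : 0 < W) (hv0 : 0 < v) (hv1 : v < 1) : ∃ X Y, IsMinimizer μ v X Y := by
  have hnn : 0 ≤ expectedTime μ v 0 0 := by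
    simpa using half_le_expectedTime hμ hv0 hv1 0 le_rfl
  set R := 2 * expectedTime μ v 0 0 + W with hR
  have hRpos : 0 < R := by positivity
  have h0 : ((0, 0) : ℝ × ℝ) ∈ Set.Icc (-R) R ×ˢ Set.Icc 0 R := by
    simp [hRpos.le]
  obtain ⟨⟨X, Y⟩, hp, hmin⟩ := (isCompact_Icc.prod isCompact_Icc).exists_isMinOn ⟨_, h0⟩
    (continuous_expectedTime (v := v) hμ).continuousOn
  refine ⟨X, Y, hp.2.1, fun X' Y' hY' => ?_⟩
  by_cases hin : (X', Y') ∈ Set.Icc (-R) R ×ˢ Set.Icc 0 R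
  · exact hmin hin
  refine (hmin h0).trans ?_
  change expectedTime μ v 0 0 ≤ _
  by_contra! hlt
  have h1 := abs_sub_le_expectedTime hμ hv0 hv1 X' Y'
  have h2 := half_le_expectedTime hμ hv0 hv1 X' hY'
  exact hin ⟨abs_le.1 (by linarith), hY', by change Y' ≤ R; linarith⟩

lemma IsMinimizer.snd_pos [IsProbabilityMeasure μ] [NullSingletonClass μ]
    (hμ : ∀ᵐ x ∂μ, x ∈ Set.Icc 0 W) (hv0 : 0 < v) (hv1 : v < 1) {X Y : ℝ} (h : IsMinimizer μ v X Y) : 0 < Y := by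
  have hk := one_sub_sq_pos_of_lt_one hv0 hv1
  refine lt_of_le_of_ne h.1 fun hY => ?_
  subst hY
  set q : ℝ → ℝ → ℝ := fun t x =>
    (√((1 - v ^ 2) * (X - x) ^ 2 + t ^ 2) - √((1 - v ^ 2) * (X - x) ^ 2)) / t with hq
  have hlim : Tendsto (fun t => ∫ x, q t x ∂μ) (nhdsWithin 0 (Set.Ioi 0))
      (nhds (∫ _, (0 : ℝ) ∂μ)) := by
    refine tendsto_integral_filter_of_dominated_convergence (fun _ => 1) ?_ ?_
      (integrable_const _) ?_
    · exact Eventually.of_forall fun t => by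
        apply Continuous.aestronglyMeasurable
        simp only [hq]
        fun_prop
    · filter_upwards [self_mem_nhdsWithin] with t ht
      have ht : 0 < t := ht
      refine Eventually.of_forall fun x => ?_
      have hA : 0 ≤ (1 - v ^ 2) * (X - x) ^ 2 := by positivity
      have h1 : √((1 - v ^ 2) * (X - x) ^ 2) ≤ √((1 - v ^ 2) * (X - x) ^ 2 + t ^ 2) :=
        Real.sqrt_le_sqrt (by nlinarith)
      have h2 : √((1 - v ^ 2) * (X - x) ^ 2 + t ^ 2) ≤ √((1 - v ^ 2) * (X - x) ^ 2) + t := by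
        refine Real.sqrt_le_iff.2 ⟨by positivity, ?_⟩
        nlinarith [Real.sq_sqrt hA, mul_nonneg (Real.sqrt_nonneg ((1 - v ^ 2) * (X - x) ^ 2)) ht.le]
      rw [Real.norm_eq_abs, abs_of_nonneg (div_nonneg (sub_nonneg.2 h1) ht.le), div_le_one ht]
      linarith
    · filter_upwards [μ.ae_ne X] with x hx
      have hA : 0 < (1 - v ^ 2) * (X - x) ^ 2 := by
        have : X - x ≠ 0 := sub_ne_zero.2 hx.symm
        positivity
      have hd : HasDerivAt (fun t : ℝ => √((1 - v ^ 2) * (X - x) ^ 2 + t ^ 2)) 0 0 := by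
        have := (((hasDerivAt_id (0 : ℝ)).pow 2).const_add
          ((1 - v ^ 2) * (X - x) ^ 2)).sqrt (by simpa using hA.ne')
        simpa using this
      have := hd.tendsto_slope.mono_left (nhdsWithin_mono 0 fun t (ht : 0 < t) => ht.ne')
      refine this.congr fun t => ?_
      simp [hq, slope_def_field]
  rw [integral_zero] at hlim
  have hge : ∀ᶠ t in nhdsWithin (0 : ℝ) (Set.Ioi 0), v ≤ ∫ x, q t x ∂μ := by
    filter_upwards [self_mem_nhdsWithin] with t ht
    have ht : 0 < t := ht
    have hle := h.2 X t ht.le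
    have hint : Integrable (fun x => interceptTime v X t x - interceptTime v X 0 x) μ :=
      (integrable_interceptTime hμ v X t).sub (integrable_interceptTime hμ v X 0)
    have heq : ∀ x, q t x = (1 - v ^ 2) / t * (interceptTime v X t x - interceptTime v X 0 x)
        + v := by
      intro x
      simp only [hq, interceptTime]
      field_simp
      ring_nf
    simp_rw [heq]
    rw [integral_add (hint.const_mul _) (integrable_const _), integral_const_mul,
      integral_sub (integrable_interceptTime hμ v X t) (integrable_interceptTime hμ v X 0)]
    have : 0 ≤ (1 - v ^ 2) / t * (expectedTime μ v X t - expectedTime μ v X 0) :=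
      mul_nonneg (by positivity) (sub_nonneg.2 hle)
    simpa [expectedTime] using this
  exact absurd (ge_of_tendsto hlim hge) (not_le.2 hv0)

lemma IsMinimizer.integral_eq_zero [IsProbabilityMeasure μ] [NullSingletonClass μ]
    (hμ : ∀ᵐ x ∂μ, x ∈ Set.Icc 0 W) (hv0 : 0 < v) (hv1 : v < 1) {X Y : ℝ}
    (h : IsMinimizer μ v X Y) :
    ∫ x, (X - x) / √((1 - v ^ 2) * (X - x) ^ 2 + Y ^ 2) ∂μ = 0 := by
  have hk := one_sub_sq_pos_of_lt_one hv0 hv1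
  have hY := h.snd_pos hμ hv0 hv1
  have hS : ∀ x, 0 < √((1 - v ^ 2) * (X - x) ^ 2 + Y ^ 2) := fun x => by positivity
  have hSc : Continuous fun x => √((1 - v ^ 2) * (X - x) ^ 2 + Y ^ 2) := by fun_prop
  have ia : Integrable (fun x => 1 / √((1 - v ^ 2) * (X - x) ^ 2 + Y ^ 2)) μ :=
    (continuous_const.div hSc fun x => (hS x).ne').integrable_of_ae_mem_Icc hμ
  have ib : Integrable (fun x => (X - x) / √((1 - v ^ 2) * (X - x) ^ 2 + Y ^ 2)) μ :=
    ((continuous_const.sub continuous_id).div hSc fun x =>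
      (hS x).ne').integrable_of_ae_mem_Icc hμ
  have hapos : 0 < ∫ x, 1 / √((1 - v ^ 2) * (X - x) ^ 2 + Y ^ 2) ∂μ := by
    simpa using integral_lt_integral_of_ae_lt (integrable_zero ℝ ℝ μ) ia
      (Eventually.of_forall fun x => one_div_pos.2 (hS x))
  have key : ∀ t : ℝ, 0 ≤ t ^ 2 / 2 * (∫ x, 1 / √((1 - v ^ 2) * (X - x) ^ 2 + Y ^ 2) ∂μ) +
      t * ∫ x, (X - x) / √((1 - v ^ 2) * (X - x) ^ 2 + Y ^ 2) ∂μ := by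
    intro t
    have hmono := integral_mono (integrable_interceptTime hμ v (X + t) Y)
      ((integrable_interceptTime hμ v X Y).add ((ia.const_mul (t ^ 2 / 2)).add (ib.const_mul t)))
      fun x => interceptTime_add_le hv0 hv1 X x t hY
    rw [integral_add' (integrable_interceptTime hμ v X Y)
      ((ia.const_mul (t ^ 2 / 2)).add (ib.const_mul t)),
      integral_add' (ia.const_mul (t ^ 2 / 2)) (ib.const_mul t),
      integral_const_mul, integral_const_mul] at hmono
    have := h.2 (X + t) Y hY.le
    unfold expectedTime at this
    linarith
  set a := ∫ x, 1 / √((1 - v ^ 2) * (X - x) ^ 2 + Y ^ 2) ∂μ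
  set b := ∫ x, (X - x) / √((1 - v ^ 2) * (X - x) ^ 2 + Y ^ 2) ∂μ
  have hb := key (-b / a)
  have e : (-b / a) ^ 2 / 2 * a + -b / a * b = -(b ^ 2 / (2 * a)) := by field_simp; ring
  rw [e] at hb
  by_contra hne
  have : 0 < b ^ 2 / (2 * a) := by positivity
  linarith

lemma IsMinimizer.fst_mem_Ioo [IsProbabilityMeasure μ] [NullSingletonClass μ]
    (hμ : ∀ᵐ x ∂μ, x ∈ Set.Icc 0 W) (hv0 : 0 < v) (hv1 : v < 1) {X Y : ℝ}
    (h : IsMinimizer μ v X Y) : X ∈ Set.Ioo 0 W := by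
  have hk := one_sub_sq_pos_of_lt_one hv0 hv1
  have hY := h.snd_pos hμ hv0 hv1
  have hb := h.integral_eq_zero hμ hv0 hv1
  have hS : ∀ x, 0 < √((1 - v ^ 2) * (X - x) ^ 2 + Y ^ 2) := fun x => by positivity
  have ib : Integrable (fun x => (X - x) / √((1 - v ^ 2) * (X - x) ^ 2 + Y ^ 2)) μ :=
    ((continuous_const.sub continuous_id).div (by fun_prop) fun x =>
      (hS x).ne').integrable_of_ae_mem_Icc hμ
  constructor <;> by_contra! hX
  · have := integral_lt_integral_of_ae_lt ib (integrable_zero ℝ ℝ μ) <| by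
      filter_upwards [ae_mem_Ioo_of_ae_mem_Icc hμ] with x hx
      exact div_neg_of_neg_of_pos (by linarith [hx.1]) (hS x)
    simp [hb] at this
  · have := integral_lt_integral_of_ae_lt (integrable_zero ℝ ℝ μ) ib <| by
      filter_upwards [ae_mem_Ioo_of_ae_mem_Icc hμ] with x hx
      exact div_pos (by linarith [hx.2]) (hS x)
    simp [hb] at this

lemma IsMinimizer.eq [IsProbabilityMeasure μ] [NullSingletonClass μ]
    (hμ : ∀ᵐ x ∂μ, x ∈ Set.Icc 0 W) (hv0 : 0 < v) (hv1 : v < 1) {X Y X' Y' : ℝ}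
    (h : IsMinimizer μ v X Y) (h' : IsMinimizer μ v X' Y') : X' = X ∧ Y' = Y := by
  have hY := h.snd_pos hμ hv0 hv1
  have hY' := h'.snd_pos hμ hv0 hv1
  by_contra hne
  have hae : ∀ᵐ x ∂μ, (X - x) * Y' ≠ (X' - x) * Y := by
    filter_upwards [μ.ae_ne ((X * Y' - X' * Y) / (Y' - Y))] with x hx heq
    by_cases hYY : Y' = Y
    · subst hYY
      exact hne ⟨by linarith [mul_right_cancel₀ hY.ne' heq], rfl⟩
    · refine hx ((eq_div_iff (sub_ne_zero.2 hYY)).2 ?_)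
      linarith
  have hlt := integral_lt_integral_of_ae_lt
    (integrable_interceptTime hμ v ((X + X') / 2) ((Y + Y') / 2))
    (((integrable_interceptTime hμ v X Y).add (integrable_interceptTime hμ v X' Y')).div_const 2)
    (hae.mono fun x hx => interceptTime_midpoint_lt hv0 hv1 hY hY' hx)
  rw [integral_div, integral_add' (integrable_interceptTime hμ v X Y)
    (integrable_interceptTime hμ v X' Y')] at hlt
  have h1 := h.2 ((X + X') / 2) ((Y + Y') / 2) (by positivity)
  have h2 := h'.2 X Y hY.le
  unfold expectedTime at h1 h2
  linarith

end Expected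

/-- The expected constrained travel time `T_exp` attains a global minimum over
ℝ × [0,∞) at a unique point `(X*,Y*)`, which satisfies `0 < X* < W` and `Y* > 0`. -/
theorem stmt_10 (W M v : ℝ) (φ : ℝ → ℝ)
    (hW : 0 < W) (hM : 0 < M) (hφm : Measurable φ)
    (hφ0 : ∀ x, 0 ≤ φ x) (hφM : ∀ x, φ x ≤ M)
    (hφs : ∀ x, x ∉ Set.Icc (0:ℝ) W → φ x = 0)
    (hφ1 : (∫ x in (0:ℝ)..W, φ x) = 1)
    (hv0 : 0 < v) (hv1 : v < 1)
    (Texp : ℝ → ℝ → ℝ)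
    (hTexp : ∀ X Y : ℝ, Texp X Y =
      ∫ x in (0:ℝ)..W,
        ((Real.sqrt ((1 - v ^ 2) * (X - x) ^ 2 + Y ^ 2) - v * Y) / (1 - v ^ 2)) * φ x) :
    ∃ Xs Ys : ℝ, 0 ≤ Ys ∧
      (∀ X Y : ℝ, 0 ≤ Y → Texp Xs Ys ≤ Texp X Y) ∧
      (∀ X' Y' : ℝ, 0 ≤ Y' → (∀ X Y : ℝ, 0 ≤ Y → Texp X' Y' ≤ Texp X Y) →
        X' = Xs ∧ Y' = Ys) ∧
      0 < Xs ∧ Xs < W ∧ 0 < Ys := by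
  set μ : Measure ℝ :=
    (volume.restrict (Set.Ioc 0 W)).withDensity fun x => ENNReal.ofReal (φ x) with hμdef
  have hint : IntegrableOn φ (Set.Ioc 0 W) :=
    Measure.integrableOn_of_bounded (M := M) (by simp) hφm.aestronglyMeasurable
      (Eventually.of_forall fun x => by
        rw [Real.norm_eq_abs, abs_of_nonneg (hφ0 x)]
        exact hφM x)
  rw [intervalIntegral.integral_of_le hW.le] at hφ1
  have : IsProbabilityMeasure μ := ⟨by
    rw [hμdef, withDensity_apply _ MeasurableSet.univ, Measure.restrict_univ,
      ← ofReal_integral_eq_lintegral_ofReal hint (Eventually.of_forall hφ0), hφ1,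
      ENNReal.ofReal_one]⟩
  have hac : μ ≪ volume.restrict (Set.Ioc 0 W) := withDensity_absolutelyContinuous _ _
  have : NullSingletonClass μ := ⟨fun x => hac (measure_singleton x)⟩
  have hμ : ∀ᵐ x ∂μ, x ∈ Set.Icc 0 W := by
    filter_upwards [hac.ae_le (ae_restrict_mem measurableSet_Ioc)] with x hx
    exact Set.mem_Icc_of_Ioc hx
  have hT : ∀ X Y, Texp X Y = expectedTime μ v X Y := by
    intro X Y
    rw [hTexp, intervalIntegral.integral_of_le hW.le, expectedTime, hμdef,
      integral_withDensity_eq_integral_toReal_smul (by fun_prop) (by simp)]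
    refine integral_congr_ae (Eventually.of_forall fun x => ?_)
    simp [interceptTime, ENNReal.toReal_ofReal (hφ0 x), mul_comm]
  simp_rw [hT]
  obtain ⟨X, Y, h⟩ := exists_isMinimizer hμ hW hv0 hv1
  have hX := h.fst_mem_Ioo hμ hv0 hv1
  exact ⟨X, Y, h.1, h.2, fun X' Y' hY' h' => h.eq hμ hv0 hv1 ⟨hY', h'⟩, hX.1, hX.2,
    h.snd_pos hμ hv0 hv1⟩
end
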